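/- Let C be a linear [n,k,d] code over F_q with k ≥ 1, and suppose 2d = n+1. Let p_i = dim P_i(C), f_i = dim F_i(C). Then min{p_{d-1}+f_{d-1}, p_d+f_d} ≤ 1; moreover if C is formally self-orthogonal then this minimum equals 0. -/

import Mathlib

variable {F : Type*} [Field F] [Fintype F] [DecidableEq F] {n : ℕ}

/-- The `i`-th past subcode: codewords of `C` vanishing on coordinates `i+1, …, n`
(identified as a subspace of `F^n` supported on the first `i` coordinates). -/
def pastCode (C : Submodule F (Fin n → F)) (i : ℕ) : Submodule F (Fin n → F) where
  carrier := {c | c ∈ C ∧ ∀ j : Fin n, i ≤ (j : ℕ) → c j = 0}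
  add_mem' := fun {a b} ha hb => ⟨C.add_mem ha.1 hb.1,
    fun j hj => by simp [Pi.add_apply, ha.2 j hj, hb.2 j hj]⟩
  zero_mem' := ⟨C.zero_mem, fun j _ => rfl⟩
  smul_mem' := fun c {x} hx => ⟨C.smul_mem c hx.1,
    fun j hj => by simp [Pi.smul_apply, hx.2 j hj]⟩

/-- The `i`-th future subcode: codewords of `C` vanishing on coordinates `1, …, i`. -/
def futureCode (C : Submodule F (Fin n → F)) (i : ℕ) : Submodule F (Fin n → F) where
  carrier := {c | c ∈ C ∧ ∀ j : Fin n, (j : ℕ) < i → c j = 0}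
  add_mem' := fun {a b} ha hb => ⟨C.add_mem ha.1 hb.1,
    fun j hj => by simp [Pi.add_apply, ha.2 j hj, hb.2 j hj]⟩
  zero_mem' := ⟨C.zero_mem, fun j _ => rfl⟩
  smul_mem' := fun c {x} hx => ⟨C.smul_mem c hx.1,
    fun j hj => by simp [Pi.smul_apply, hx.2 j hj]⟩

/-- The dual code with respect to the standard bilinear form. -/
def dualCode (C : Submodule F (Fin n → F)) : Submodule F (Fin n → F) where
  carrier := {y | ∀ c ∈ C, ∑ j, y j * c j = 0}
  add_mem' := fun {a b} ha hb c hc => by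
    simp [Pi.add_apply, add_mul, Finset.sum_add_distrib, ha c hc, hb c hc]
  zero_mem' := fun c _ => by simp
  smul_mem' := fun t {x} hx c hc => by
    simp [Pi.smul_apply, mul_assoc, ← Finset.mul_sum, hx c hc]

/-- `C` is formally self-orthogonal: `C ⊆ x * C^⊥` for some tuple `x` of
nonzero field elements, with `*` the coordinatewise multiplication. -/
def FormallySelfOrthogonal (C : Submodule F (Fin n → F)) : Prop :=
  ∃ x : Fin n → F, (∀ j, x j ≠ 0) ∧
    ∀ c ∈ C, ∃ y ∈ dualCode C, c = fun j => x j * y j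

/-- For an `[n,k,d]` code with `k ≥ 1` and `2d = n+1`,
`min (p_{d-1}+f_{d-1}) (p_d+f_d) ≤ 1`; if moreover `C` is formally
self-orthogonal then this minimum is `0`. -/
theorem border_case_state_complexity
    {F : Type*} [Field F] [Fintype F] [DecidableEq F] {n k d : ℕ}
    (C : Submodule F (Fin n → F)) (hk : Module.finrank F C = k) (hk1 : 1 ≤ k)
    (hdist : ∀ c ∈ C, c ≠ 0 → d ≤ hammingNorm c)
    (hdist' : ∃ c ∈ C, c ≠ 0 ∧ hammingNorm c = d)
    (h2d : 2 * d = n + 1) :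
    min (Module.finrank F (pastCode C (d - 1)) + Module.finrank F (futureCode C (d - 1)))
        (Module.finrank F (pastCode C d) + Module.finrank F (futureCode C d)) ≤ 1 ∧
    (FormallySelfOrthogonal C →
      min (Module.finrank F (pastCode C (d - 1)) + Module.finrank F (futureCode C (d - 1)))
          (Module.finrank F (pastCode C d) + Module.finrank F (futureCode C d)) = 0) := by
  classical
  have hd1 : 1 ≤ d := by omega
  have hP0 : ∀ c ∈ C, (∀ j : Fin n, d - 1 ≤ (j : ℕ) → c j = 0) → c = 0 := by
    intro c hc h
    by_contra hne
    have h1 := hdist c hc hne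
    have h2 : hammingNorm c ≤ (Finset.range (d - 1)).card := by
      unfold hammingNorm
      apply Finset.card_le_card_of_injOn (fun j : Fin n => (j : ℕ))
      · intro j hj
        simp only [Finset.coe_filter, Finset.mem_univ, true_and, Set.mem_setOf_eq] at hj
        simp only [Finset.coe_range, Set.mem_Iio]
        by_contra hlt
        exact hj (h j (by omega))
      · intro a _ b _ hab
        exact Fin.ext hab
    rw [Finset.card_range] at h2
    omega
  have hF0 : ∀ c ∈ C, (∀ j : Fin n, (j : ℕ) < d → c j = 0) → c = 0 := by
    intro c hc h
    by_contra hne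
    have h1 := hdist c hc hne
    have h2 : hammingNorm c ≤ (Finset.Ico d n).card := by
      unfold hammingNorm
      apply Finset.card_le_card_of_injOn (fun j : Fin n => (j : ℕ))
      · intro j hj
        simp only [Finset.coe_filter, Finset.mem_univ, true_and, Set.mem_setOf_eq] at hj
        simp only [Finset.coe_Ico, Set.mem_Ico]
        refine ⟨?_, j.2⟩
        by_contra hlt
        exact hj (h j (by omega))
      · intro a _ b _ hab
        exact Fin.ext hab
    rw [Nat.card_Ico] at h2
    omega
  have hpb : pastCode C (d - 1) = ⊥ := by
    rw [eq_bot_iff]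
    intro c hc
    exact hP0 c hc.1 hc.2
  have hfb : futureCode C d = ⊥ := by
    rw [eq_bot_iff]
    intro c hc
    exact hF0 c hc.1 hc.2
  let m : Fin n := ⟨d - 1, by omega⟩
  have hPm : ∀ c ∈ pastCode C d, c m = 0 → c = 0 := by
    intro c hc hm
    refine hP0 c hc.1 fun j hj => ?_
    by_cases hjd : d ≤ (j : ℕ)
    · exact hc.2 j hjd
    · have : j = m := Fin.ext (show (j : ℕ) = d - 1 by omega)
      rw [this, hm]
  have hFm : ∀ c ∈ futureCode C (d - 1), c m = 0 → c = 0 := by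
    intro c hc hm
    refine hF0 c hc.1 fun j hj => ?_
    by_cases hjd : (j : ℕ) < d - 1
    · exact hc.2 j hjd
    · have : j = m := Fin.ext (show (j : ℕ) = d - 1 by omega)
      rw [this, hm]
  have hp1 : Module.finrank F (pastCode C d) ≤ 1 := by
    have hinj : Function.Injective
        ((LinearMap.proj m : (Fin n → F) →ₗ[F] F) ∘ₗ (pastCode C d).subtype) := by
      rw [injective_iff_map_eq_zero]
      intro c hc
      exact Subtype.ext (hPm c c.2 hc)
    have := LinearMap.finrank_le_finrank_of_injective hinj
    rwa [Module.finrank_self] at this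
  rw [hpb, hfb, finrank_bot]
  refine ⟨(min_le_right _ _).trans (by omega), ?_⟩
  rintro ⟨x, hx, hC⟩
  by_cases hP : pastCode C d = ⊥
  · rw [hP, finrank_bot]; simp
  · have hF : futureCode C (d - 1) = ⊥ := by
      obtain ⟨a, ha, hane⟩ := (Submodule.ne_bot_iff _).1 hP
      rw [eq_bot_iff]
      intro b hb
      refine hFm b hb ?_
      obtain ⟨y, hy, hay⟩ := hC a ha.1
      have hsum := hy b hb.1
      rw [Finset.sum_eq_single m] at hsum
      · rcases mul_eq_zero.1 hsum with h | h
        · exact absurd (hPm a ha (by rw [hay]; simp [h])) hane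
        · exact h
      · intro j _ hj
        by_cases hjd : (j : ℕ) < d - 1
        · rw [hb.2 j hjd, mul_zero]
        · have hj' : (j : ℕ) ≠ d - 1 := fun h => hj (Fin.ext h)
          have h0 := ha.2 j (by omega)
          rw [hay] at h0
          rw [(mul_eq_zero.1 h0).resolve_left (hx j), zero_mul]
      · intro h
        exact absurd (Finset.mem_univ m) h
    rw [hF, finrank_bot]; simp
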